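/- For a memoryless point-to-point communication system with causal encoder (converse direction of Theorem 2): if a pmf P_{SXYŜ} on 𝒮×𝒳×𝒴×Ŝ is achievable with a causal encoder, then there exist finite sets 𝒰, 𝒱 and a joint pmf P_{SXYŜUV} whose (S,X,Y,Ŝ)-marginal is P_{SXYŜ}, which factors as P_S(s)·P_U(u)·P_{V|SU}(v|s,u)·P_{X|SU}(x|s,u)·P_{Y|X}(y|x)·P_{Ŝ|UVY}(ŝ|u,v,y), and which satisfies I(U,V;S) ≤ I(U,V;Y). -/

import Mathlib

open scoped BigOperators

noncomputable section

/-- `p` is a probability mass function on the finite type `α`. -/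
def IsPMF {α : Type*} [Fintype α] (p : α → ℝ) : Prop :=
  (∀ a, 0 ≤ p a) ∧ (∑ a, p a) = 1

/-- Probability of the event `E` under the pmf `P`. -/
def prob {Ω : Type*} [Fintype Ω] (P : Ω → ℝ) (E : Set Ω) : ℝ :=
  ∑ ω, E.indicator P ω

/-- Probability that the random variable `f` takes the value `a`, under `P`. -/
def margProb {Ω A : Type*} [Fintype Ω] (P : Ω → ℝ) (f : Ω → A) (a : A) : ℝ :=
  prob P {ω | f ω = a}

/-- Mutual information `I(f;g)` (base-2 logarithms) of random variables `f`, `g`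
defined on a finite probability space with pmf `P`. -/
def mutInfo {Ω A B : Type*} [Fintype Ω] [Fintype A] [Fintype B]
    (P : Ω → ℝ) (f : Ω → A) (g : Ω → B) : ℝ :=
  ∑ a : A, ∑ b : B,
    margProb P (fun ω => (f ω, g ω)) (a, b) *
      Real.logb 2 (margProb P (fun ω => (f ω, g ω)) (a, b) /
        (margProb P f a * margProb P g b))

/-- Conditional mutual information `I(f;g|h)` (base-2 logarithms). -/
def condMutInfo {Ω A B C : Type*} [Fintype Ω] [Fintype A] [Fintype B] [Fintype C]
    (P : Ω → ℝ) (f : Ω → A) (g : Ω → B) (h : Ω → C) : ℝ :=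
  ∑ a : A, ∑ b : B, ∑ c : C,
    margProb P (fun ω => (f ω, g ω, h ω)) (a, b, c) *
      Real.logb 2
        ((margProb P (fun ω => (f ω, g ω, h ω)) (a, b, c) * margProb P h c) /
          (margProb P (fun ω => (f ω, h ω)) (a, c) *
            margProb P (fun ω => (g ω, h ω)) (b, c)))

/-- Total variation distance between two pmfs: half the ℓ¹ distance. -/
def tvDist {α : Type*} [Fintype α] (P Q : α → ℝ) : ℝ :=
  (∑ a, |P a - Q a|) / 2

/-- Empirical distribution of the sequence `w`. -/
def empDist {n : ℕ} {α : Type*} (w : Fin n → α) (a : α) : ℝ :=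
  (∑ i : Fin n, ({i | w i = a} : Set (Fin n)).indicator (fun _ => (1 : ℝ)) i) / n

/-- Causality classes for the encoder. -/
inductive EncoderClass | noncausal | causal | strictlyCausal

/-- The encoder `f` respects the causality class `c`:
a noncausal encoder has `Xᵢ = fᵢ(Sⁿ)`, a causal encoder has `Xᵢ = fᵢ(Sⁱ)`
(it only depends on `S₁,…,Sᵢ`), and a strictly causal encoder has
`Xᵢ = fᵢ(Sⁱ⁻¹)` (it only depends on `S₁,…,Sᵢ₋₁`). -/
def EncOK {n : ℕ} {S X : Type*} : EncoderClass → (Fin n → (Fin n → S) → X) → Prop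
  | .noncausal, _ => True
  | .causal, f => ∀ (i : Fin n) (s s' : Fin n → S),
      (∀ j, j ≤ i → s j = s' j) → f i s = f i s'
  | .strictlyCausal, f => ∀ (i : Fin n) (s s' : Fin n → S),
      (∀ j, j < i → s j = s' j) → f i s = f i s'

/-- The joint pmf of `(Sⁿ, Yⁿ)` induced by the i.i.d. source `PS`, the memoryless
channel `PYX` and the (deterministic) encoder `f`. -/
def inducedP {S X Y : Type*} {n : ℕ}
    (PS : S → ℝ) (PYX : X → Y → ℝ) (f : Fin n → (Fin n → S) → X) :
    (Fin n → S) × (Fin n → Y) → ℝ :=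
  fun sy => (∏ i, PS (sy.1 i)) * ∏ i, PYX (f i sy.1) (sy.2 i)

/-- `P` (a pmf on `S × X × Y × Z`) is achievable for the source `PS` and channel `PYX`
with an encoder of causality class `c`: for every `ε > 0` there are a block length
`n` and a block-`n` code such that with probability at least `1 - ε` the empirical
distribution of `(Sⁿ, Xⁿ, Yⁿ, Ŝⁿ)` is within total variation `ε` of `P`. -/
def Achievable {S X Y Z : Type*} [Fintype S] [Fintype X] [Fintype Y] [Fintype Z]
    (PS : S → ℝ) (PYX : X → Y → ℝ) (c : EncoderClass)
    (P : S × X × Y × Z → ℝ) : Prop :=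
  ∀ ε : ℝ, 0 < ε →
    ∃ n : ℕ, 0 < n ∧
      ∃ (f : Fin n → (Fin n → S) → X) (g : Fin n → (Fin n → Y) → Z),
        EncOK c f ∧
        prob (inducedP PS PYX f)
          {sy | ε <
            tvDist (empDist (fun i => (sy.1 i, f i sy.1, sy.2 i, g i sy.2))) P} < ε

section ConvexHull

variable {E : Type*} [AddCommGroup E] [Module ℝ E] [FiniteDimensional ℝ E]

/-- Carathéodory's theorem with a fixed number of points. -/
theorem exists_fin_sum_smul_of_mem_convexHull {s : Set E} {x : E} (hx : x ∈ convexHull ℝ s) :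
    ∃ (w : Fin (Module.finrank ℝ E + 1) → ℝ) (z : Fin (Module.finrank ℝ E + 1) → E),
      (∀ i, 0 ≤ w i) ∧ ∑ i, w i = 1 ∧ (∀ i, z i ∈ s) ∧ ∑ i, w i • z i = x := by
  classical
  obtain ⟨x₀, hx₀⟩ : s.Nonempty := convexHull_nonempty_iff.1 ⟨x, hx⟩
  obtain ⟨ι, _, z, w, hzs, hind, hwpos, hw1, hwz⟩ := eq_pos_convex_span_of_mem_convexHull hx
  have hcard : Fintype.card ι ≤ Fintype.card (Fin (Module.finrank ℝ E + 1)) := by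
    rw [Fintype.card_fin]
    exact hind.card_le_finrank_succ.trans (Nat.succ_le_succ (Submodule.finrank_le _))
  obtain ⟨e⟩ := Function.Embedding.nonempty_of_card_le hcard
  have hzero : ∀ j ∉ Finset.univ.map e, Function.extend e w 0 j = 0 := by
    intro j hj
    exact Function.extend_apply' _ _ _ fun ⟨i, hi⟩ => hj (by simp [← hi])
  refine ⟨Function.extend e w 0, Function.extend e z fun _ => x₀, ?_, ?_, ?_, ?_⟩
  · intro j
    by_cases hj : ∃ i, e i = j
    · obtain ⟨i, rfl⟩ := hj
      simpa [e.injective.extend_apply] using (hwpos i).le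
    · simp [Function.extend_apply' _ _ _ hj]
  · rw [← Finset.sum_subset (Finset.subset_univ (Finset.univ.map e)) fun j _ hj => hzero j hj,
      Finset.sum_map]
    simpa [e.injective.extend_apply] using hw1
  · intro j
    by_cases hj : ∃ i, e i = j
    · obtain ⟨i, rfl⟩ := hj
      simpa [e.injective.extend_apply] using hzs ⟨i, rfl⟩
    · simpa [Function.extend_apply' _ _ _ hj] using hx₀
  · rw [← Finset.sum_subset (Finset.subset_univ (Finset.univ.map e))
        fun j _ hj => by rw [hzero j hj, zero_smul],
      Finset.sum_map]
    simpa [e.injective.extend_apply] using hwz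

theorem IsCompact.convexHull_of_finiteDimensional [TopologicalSpace E] [ContinuousAdd E]
    [ContinuousSMul ℝ E] {s : Set E} (hs : IsCompact s) : IsCompact (convexHull ℝ s) := by
  have hK : IsCompact (stdSimplex ℝ (Fin (Module.finrank ℝ E + 1)) ×ˢ
      Set.univ.pi fun _ : Fin (Module.finrank ℝ E + 1) => s) :=
    (isCompact_stdSimplex ℝ _).prod (isCompact_univ_pi fun _ => hs)
  have himage : (fun p : (Fin (Module.finrank ℝ E + 1) → ℝ) × (Fin (Module.finrank ℝ E + 1) → E) =>
      ∑ i, p.1 i • p.2 i) '' (stdSimplex ℝ (Fin (Module.finrank ℝ E + 1)) ×ˢ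
        Set.univ.pi fun _ : Fin (Module.finrank ℝ E + 1) => s) = convexHull ℝ s := by
    apply Set.Subset.antisymm
    · rintro _ ⟨⟨w, z⟩, ⟨hw, hz⟩, rfl⟩
      exact mem_convexHull_of_exists_fintype w z hw.1 hw.2 (fun i => hz i trivial) rfl
    · intro x hx
      obtain ⟨w, z, hw0, hw1, hz, rfl⟩ := exists_fin_sum_smul_of_mem_convexHull hx
      exact ⟨(w, z), ⟨⟨hw0, hw1⟩, fun i _ => hz i⟩, rfl⟩
  rw [← himage]
  exact hK.image (by fun_prop)

end ConvexHull

section Region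

open scoped Classical

variable {S X Y Z : Type} [Fintype S] [Fintype X] [Fintype Y] [Fintype Z]

/-- Mass of the channel output when the state has mass function `q` and the input is `t s`. -/
def chanOut (PYX : X → Y → ℝ) (t : S → X) (q : S → ℝ) (y : Y) : ℝ :=
  ∑ s, q s * PYX (t s) y

/-- The joint mass function of `(S, X, Y, Ŝ)` and the entropy difference `H(S) - H(Y)` when `S`
has mass function `q`, `X = t S` and `Ŝ = h Y`. -/
def letterPoint (PYX : X → Y → ℝ) (t : S → X) (h : Y → Z) (q : S → ℝ) :
    (S × X × Y × Z → ℝ) × ℝ :=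
  (fun a => if a.2.1 = t a.1 ∧ a.2.2.2 = h a.2.2.1 then q a.1 * PYX a.2.1 a.2.2.1 else 0,
    ∑ s, Real.negMulLog (q s) - ∑ y, Real.negMulLog (chanOut PYX t q y))

/-- All points `letterPoint PYX t h q` for a fixed input map `t`. -/
def letterSet (Z : Type) (PYX : X → Y → ℝ) (t : S → X) :
    Set ((S × X × Y × Z → ℝ) × ℝ) :=
  ⋃ h : Y → Z, letterPoint PYX t h '' stdSimplex ℝ S

/-- Points reached with a constant `U`. -/
def strategySet (Z : Type) [Fintype Z] (PS : S → ℝ) (PYX : X → Y → ℝ) :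
    Set ((S × X × Y × Z → ℝ) × ℝ) :=
  ⋃ t : S → X, convexHull ℝ (letterSet Z PYX t) ∩
    {p | ∀ s, ∑ x, ∑ y, ∑ z, p.1 (s, x, y, z) = PS s}

/-- Pairs of a joint pmf of `(S, X, Y, Ŝ)` and a value of `H(S|UV) - H(Y|UV)` reached by some
auxiliary variables `U`, `V`. -/
def causalRegion (Z : Type) [Fintype Z] (PS : S → ℝ) (PYX : X → Y → ℝ) :
    Set ((S × X × Y × Z → ℝ) × ℝ) :=
  convexHull ℝ (strategySet Z PS PYX)

theorem isCompact_causalRegion (PS : S → ℝ) (PYX : X → Y → ℝ) :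
    IsCompact (causalRegion Z PS PYX) := by
  refine IsCompact.convexHull_of_finiteDimensional (isCompact_iUnion fun t => ?_)
  refine (IsCompact.convexHull_of_finiteDimensional (isCompact_iUnion fun h => ?_)).inter_right ?_
  · refine (isCompact_stdSimplex ℝ S).image ?_
    refine Continuous.prodMk (continuous_pi fun a => ?_) ?_
    · split_ifs <;> fun_prop
    · unfold chanOut
      have := Real.continuous_negMulLog
      fun_prop
  · simp only [Set.ofPred_forall]
    exact isClosed_iInter fun s => isClosed_eq (by fun_prop) continuous_const

omit [Fintype X] in
theorem sum_chanOut {PYX : X → Y → ℝ} (hPYX : ∀ x, IsPMF (PYX x)) (t : S → X) (q : S → ℝ) :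
    ∑ y, chanOut PYX t q y = ∑ s, q s := by
  unfold chanOut
  rw [Finset.sum_comm]
  simp [← Finset.mul_sum, (hPYX _).2]

theorem sum_letterPoint {PYX : X → Y → ℝ} (hPYX : ∀ x, IsPMF (PYX x)) (t : S → X) (h : Y → Z)
    (q : S → ℝ) (s : S) : ∑ x, ∑ y, ∑ z, (letterPoint PYX t h q).1 (s, x, y, z) = q s := by
  simp [letterPoint, ite_and, ← Finset.mul_sum, (hPYX _).2]

theorem sum_sum_letterPoint {V : Type*} [Fintype V] {PYX : X → Y → ℝ} (hPYX : ∀ x, IsPMF (PYX x))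
    (t : S → X) (h : V → Y → Z) (q : V → S → ℝ) (s : S) :
    ∑ x, ∑ y, ∑ z, (∑ v, letterPoint PYX t (h v) (q v)).1 (s, x, y, z) = ∑ v, q v s := by
  simp only [← fun v => sum_letterPoint hPYX t (h v) (q v) s, Prod.fst_sum, Finset.sum_apply]
  simp only [Finset.sum_comm (s := (Finset.univ : Finset V))]

omit [Fintype X] [Fintype Z] in
theorem letterPoint_smul {PYX : X → Y → ℝ} (hPYX : ∀ x, IsPMF (PYX x)) (t : S → X) (h : Y → Z)
    (c : ℝ) (q : S → ℝ) : letterPoint PYX t h (c • q) = c • letterPoint PYX t h q := by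
  have hc : ∀ y, chanOut PYX t (c • q) y = c * chanOut PYX t q y := by
    intro y
    simp [chanOut, Finset.mul_sum, mul_assoc]
  refine Prod.ext ?_ ?_
  · ext a
    simp [letterPoint, mul_assoc]
  · simp only [letterPoint, hc, Pi.smul_apply, smul_eq_mul, Real.negMulLog_mul, Prod.smul_mk,
      Finset.sum_add_distrib, ← Finset.sum_mul, ← Finset.mul_sum, sum_chanOut hPYX]
    ring

omit [Fintype X] [Fintype Z] in
theorem letterPoint_zero {PYX : X → Y → ℝ} (hPYX : ∀ x, IsPMF (PYX x)) (t : S → X) (h : Y → Z) :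
    letterPoint PYX t h 0 = 0 := by
  simpa using letterPoint_smul hPYX t h 0 0

omit [Fintype X] [Fintype Z] in
theorem sum_letterPoint_mem_convexHull [Nonempty S] {V : Type*} [Fintype V] {PYX : X → Y → ℝ}
    (hPYX : ∀ x, IsPMF (PYX x)) (t : S → X) (h : V → Y → Z) (q : V → S → ℝ)
    (hq : ∀ v s, 0 ≤ q v s) (hq1 : ∑ v, ∑ s, q v s = 1) :
    ∑ v, letterPoint PYX t (h v) (q v) ∈ convexHull ℝ (letterSet Z PYX t) := by
  have key : ∀ v, ∃ p ∈ stdSimplex ℝ S, q v = (∑ s, q v s) • p := by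
    intro v
    rcases eq_or_ne (∑ s, q v s) 0 with h0 | h0
    · refine ⟨Pi.single (Classical.arbitrary S) 1, single_mem_stdSimplex ℝ _, ?_⟩
      ext s
      rw [h0, zero_smul]
      exact (Finset.sum_eq_zero_iff_of_nonneg fun s _ => hq v s).1 h0 s (Finset.mem_univ s)
    · refine ⟨(∑ s, q v s)⁻¹ • q v, ⟨fun s => ?_, ?_⟩, ?_⟩
      · exact mul_nonneg (inv_nonneg.2 (Finset.sum_nonneg fun s _ => hq v s)) (hq v s)
      · simp [← Finset.mul_sum, h0]
      · rw [smul_smul, mul_inv_cancel₀ h0, one_smul]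
  choose p hp hqp using key
  refine mem_convexHull_of_exists_fintype (fun v => ∑ s, q v s)
    (fun v => letterPoint PYX t (h v) (p v)) (fun v => Finset.sum_nonneg fun s _ => hq v s) hq1
    (fun v => Set.mem_iUnion.2 ⟨h v, p v, hp v, rfl⟩) ?_
  refine Finset.sum_congr rfl fun v _ => ?_
  rw [← letterPoint_smul hPYX, ← hqp]

theorem sum_letterPoint_mem_causalRegion {U V : Type*} [Fintype U] [Fintype V] {PS : S → ℝ}
    (hPS : IsPMF PS) {PYX : X → Y → ℝ} (hPYX : ∀ x, IsPMF (PYX x)) (t : U → S → X)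
    (h : U → V → Y → Z) (a : U → ℝ) (ha : ∀ u, 0 ≤ a u) (ha1 : ∑ u, a u = 1)
    (q : U → V → S → ℝ) (hq : ∀ u v s, 0 ≤ q u v s) (hqa : ∀ u s, ∑ v, q u v s = a u * PS s) :
    ∑ u, ∑ v, letterPoint PYX (t u) (h u v) (q u v) ∈ causalRegion Z PS PYX := by
  have hS : Nonempty S := by
    by_contra hne
    rw [not_nonempty_iff] at hne
    simpa using hPS.2
  have hpos : ∀ u, a u ≠ 0 → ∃ c ∈ strategySet Z PS PYX,
      ∑ v, letterPoint PYX (t u) (h u v) (q u v) = a u • c := by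
    intro u hu
    have hS1 : ∀ s, ∑ v, ((a u)⁻¹ • q u v) s = PS s := by
      intro s
      simp [← Finset.mul_sum, hqa, hu]
    refine ⟨∑ v, letterPoint PYX (t u) (h u v) ((a u)⁻¹ • q u v),
      Set.mem_iUnion.2 ⟨t u, ?_, ?_⟩, ?_⟩
    · refine sum_letterPoint_mem_convexHull hPYX _ _ _
        (fun v s => mul_nonneg (inv_nonneg.2 (ha u)) (hq u v s)) ?_
      rw [Finset.sum_comm]
      simp only [hS1, hPS.2]
    · intro s
      rw [← hS1 s]
      exact sum_sum_letterPoint hPYX _ _ _ s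
    · simp only [letterPoint_smul hPYX, ← Finset.smul_sum, smul_smul, mul_inv_cancel₀ hu, one_smul]
  obtain ⟨u₀, hu₀⟩ : ∃ u, a u ≠ 0 := by
    by_contra! hall
    simp [hall] at ha1
  obtain ⟨c₀, hc₀, -⟩ := hpos u₀ hu₀
  have key : ∀ u, ∃ c ∈ strategySet Z PS PYX,
      ∑ v, letterPoint PYX (t u) (h u v) (q u v) = a u • c := by
    intro u
    rcases eq_or_ne (a u) 0 with hu | hu
    · refine ⟨c₀, hc₀, ?_⟩
      have hq0 : ∀ v, q u v = 0 := by
        intro v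
        ext s
        have := hqa u s
        rw [hu, zero_mul] at this
        exact (Finset.sum_eq_zero_iff_of_nonneg fun v _ => hq u v s).1 this v (Finset.mem_univ v)
      simp [hq0, letterPoint_zero hPYX, hu]
    · exact hpos u hu
  choose c hc hqc using key
  exact mem_convexHull_of_exists_fintype a c ha ha1 hc
    (Finset.sum_congr rfl fun u _ => (hqc u).symm)

theorem exists_of_mem_causalRegion {PS : S → ℝ} {PYX : X → Y → ℝ} (hPYX : ∀ x, IsPMF (PYX x))
    {x : (S × X × Y × Z → ℝ) × ℝ} (hx : x ∈ causalRegion Z PS PYX) :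
    ∃ (m k : ℕ) (w : Fin m → ℝ) (l : Fin m → Fin k → ℝ) (t : Fin m → S → X)
      (h : Fin m → Fin k → Y → Z) (p : Fin m → Fin k → S → ℝ),
      IsPMF w ∧ (∀ u, IsPMF (l u)) ∧ (∀ u v, IsPMF (p u v)) ∧
      (∀ u s, ∑ v, l u v * p u v s = PS s) ∧
      x = ∑ u, ∑ v, letterPoint PYX (t u) (h u v) ((w u * l u v) • p u v) := by
  obtain ⟨w, c, hw0, hw1, hc, rfl⟩ := exists_fin_sum_smul_of_mem_convexHull hx
  choose t ht using fun u => Set.mem_iUnion.1 (hc u)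
  choose l d hl0 hl1 hd hld using fun u => exists_fin_sum_smul_of_mem_convexHull (ht u).1
  choose h hh using fun u v => Set.mem_iUnion.1 (hd u v)
  choose p hp hph using hh
  refine ⟨_, _, w, l, t, h, p, ⟨hw0, hw1⟩, fun u => ⟨hl0 u, hl1 u⟩, hp, fun u s => ?_, ?_⟩
  · rw [← (ht u).2 s, ← hld u]
    simp only [← hph, ← letterPoint_smul hPYX]
    exact (sum_sum_letterPoint hPYX (t u) (h u) (fun v => l u v • p u v) s).symm
  · refine Finset.sum_congr rfl fun u _ => ?_
    rw [← hld u, Finset.smul_sum]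
    refine Finset.sum_congr rfl fun v _ => ?_
    rw [letterPoint_smul hPYX, hph, smul_smul]

end Region

section FiniteEntropy

open scoped Classical

variable {Ω A B C : Type*} [Fintype Ω] [Fintype A] [Fintype B] [Fintype C]

omit [Fintype A] in
theorem margProb_eq_sum_ite (P : Ω → ℝ) (f : Ω → A) (a : A) :
    margProb P f a = ∑ ω, if f ω = a then P ω else 0 := by
  simp [margProb, prob, Set.indicator_apply]

omit [Fintype A] in
theorem margProb_nonneg {P : Ω → ℝ} (hP : ∀ ω, 0 ≤ P ω) (f : Ω → A) (a : A) :
    0 ≤ margProb P f a := by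
  rw [margProb_eq_sum_ite]
  exact Finset.sum_nonneg fun ω _ => by split_ifs <;> simp [hP]

omit [Fintype A] in
theorem le_margProb {P : Ω → ℝ} (hP : ∀ ω, 0 ≤ P ω) (f : Ω → A) (ω : Ω) :
    P ω ≤ margProb P f (f ω) := by
  rw [margProb_eq_sum_ite]
  refine le_trans (by simp) (Finset.single_le_sum
    (f := fun ω' => if f ω' = f ω then P ω' else 0) ?_ (Finset.mem_univ ω))
  exact fun ω' _ => by split_ifs <;> simp [hP]

theorem sum_margProb_mul (P : Ω → ℝ) (f : Ω → A) (F : A → ℝ) :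
    ∑ a, margProb P f a * F a = ∑ ω, P ω * F (f ω) := by
  simp only [margProb_eq_sum_ite, Finset.sum_mul, ite_mul, zero_mul]
  rw [Finset.sum_comm]
  simp

theorem sum_margProb (P : Ω → ℝ) (f : Ω → A) : ∑ a, margProb P f a = ∑ ω, P ω := by
  simpa using sum_margProb_mul P f fun _ => 1

omit [Fintype A] in
theorem sum_margProb_prodMk_right (P : Ω → ℝ) (f : Ω → A) (g : Ω → B) (a : A) :
    ∑ b, margProb P (fun ω => (f ω, g ω)) (a, b) = margProb P f a := by
  simp only [margProb_eq_sum_ite, Prod.mk.injEq]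
  rw [Finset.sum_comm]
  simp [ite_and]

omit [Fintype B] in
theorem sum_margProb_prodMk_left (P : Ω → ℝ) (f : Ω → A) (g : Ω → B) (b : B) :
    ∑ a, margProb P (fun ω => (f ω, g ω)) (a, b) = margProb P g b := by
  simp only [margProb_eq_sum_ite, Prod.mk.injEq]
  rw [Finset.sum_comm]
  simp [ite_and]

omit [Fintype A] [Fintype B] in
theorem margProb_congr (P : Ω → ℝ) {f : Ω → A} {g : Ω → B} {a : A} {b : B}
    (h : ∀ ω, f ω = a ↔ g ω = b) : margProb P f a = margProb P g b := by
  simp [margProb_eq_sum_ite, h]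

/-- Entropy of the random variable `f`, in nats. -/
def natEntropy (P : Ω → ℝ) (f : Ω → A) : ℝ :=
  ∑ a, Real.negMulLog (margProb P f a)

theorem natEntropy_eq_sum (P : Ω → ℝ) (f : Ω → A) :
    natEntropy P f = -∑ ω, P ω * Real.log (margProb P f (f ω)) := by
  rw [← sum_margProb_mul P f fun a => Real.log (margProb P f a), ← Finset.sum_neg_distrib]
  simp [natEntropy, Real.negMulLog]

theorem mutInfo_eq {P : Ω → ℝ} (hP : ∀ ω, 0 ≤ P ω) (f : Ω → A) (g : Ω → B) :
    mutInfo P f g =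
      (natEntropy P f + natEntropy P g - natEntropy P fun ω => (f ω, g ω)) / Real.log 2 := by
  have hterm : ∀ c : A × B, margProb P (fun ω => (f ω, g ω)) c *
      Real.logb 2 (margProb P (fun ω => (f ω, g ω)) c / (margProb P f c.1 * margProb P g c.2)) =
      margProb P (fun ω => (f ω, g ω)) c *
        ((Real.log (margProb P (fun ω => (f ω, g ω)) c) - Real.log (margProb P f c.1)
          - Real.log (margProb P g c.2)) / Real.log 2) := by
    intro c
    rcases eq_or_ne (margProb P (fun ω => (f ω, g ω)) c) 0 with h0 | h0
    · simp [h0]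
    have hf : margProb P f c.1 ≠ 0 := by
      intro hz
      rw [← sum_margProb_prodMk_right P f g] at hz
      exact h0 ((Finset.sum_eq_zero_iff_of_nonneg fun b _ => margProb_nonneg hP _ _).1 hz c.2
        (Finset.mem_univ _))
    have hg : margProb P g c.2 ≠ 0 := by
      intro hz
      rw [← sum_margProb_prodMk_left P f g] at hz
      exact h0 ((Finset.sum_eq_zero_iff_of_nonneg fun b _ => margProb_nonneg hP _ _).1 hz c.1
        (Finset.mem_univ _))
    rw [Real.logb, Real.log_div h0 (mul_ne_zero hf hg), Real.log_mul hf hg, sub_sub]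
  unfold mutInfo
  rw [← Fintype.sum_prod_type' (f := fun a b => margProb P (fun ω => (f ω, g ω)) (a, b) *
    Real.logb 2 (margProb P (fun ω => (f ω, g ω)) (a, b) / (margProb P f a * margProb P g b)))]
  rw [Finset.sum_congr rfl fun c _ => hterm c, sum_margProb_mul P (fun ω => (f ω, g ω)) fun c =>
    (Real.log (margProb P (fun ω => (f ω, g ω)) c) - Real.log (margProb P f c.1)
      - Real.log (margProb P g c.2)) / Real.log 2]
  simp only [natEntropy_eq_sum, mul_div_assoc', ← Finset.sum_div, mul_sub, Finset.sum_sub_distrib]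
  ring

/-- Gibbs' inequality. -/
theorem natEntropy_le_sum_log {P : Ω → ℝ} (hP : IsPMF P) (f : Ω → A) {R : A → ℝ}
    (hR : IsPMF R) (hpos : ∀ ω, P ω ≠ 0 → 0 < R (f ω)) :
    natEntropy P f ≤ -∑ ω, P ω * Real.log (R (f ω)) := by
  have hterm : ∀ a, Real.negMulLog (margProb P f a) + margProb P f a * Real.log (R a) ≤
      R a - margProb P f a := by
    intro a
    rcases (margProb_nonneg hP.1 f a).eq_or_lt with h0 | h0
    · simp [← h0, hR.1 a]
    have hRa : 0 < R a := by
      by_contra hneg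
      refine h0.ne' ?_
      rw [margProb_eq_sum_ite]
      refine Finset.sum_eq_zero fun ω _ => ?_
      split_ifs with hω
      · by_contra hne
        exact hneg (hω ▸ hpos ω hne)
      · rfl
    have hlog := Real.log_le_sub_one_of_pos (div_pos hRa h0)
    rw [Real.log_div hRa.ne' h0.ne'] at hlog
    have := mul_le_mul_of_nonneg_left hlog h0.le
    rw [mul_sub_one, mul_div_cancel₀ _ h0.ne'] at this
    simp only [Real.negMulLog]
    linarith
  have hsum := Finset.sum_le_sum fun a (_ : a ∈ Finset.univ) => hterm a
  rw [Finset.sum_add_distrib, sum_margProb_mul P f fun a => Real.log (R a),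
    Finset.sum_sub_distrib, sum_margProb, hP.2, hR.2] at hsum
  unfold natEntropy
  linarith

end FiniteEntropy

section Extraction

open scoped Classical

variable {S X Y Z : Type} [Fintype S] [Fintype X] [Fintype Y] [Fintype Z]

theorem sum_letterPoint_output (PYX : X → Y → ℝ) (t : S → X) (h : Y → Z) (q : S → ℝ) (y : Y) :
    ∑ s, ∑ x, ∑ z, (letterPoint PYX t h q).1 (s, x, y, z) = chanOut PYX t q y := by
  simp [letterPoint, ite_and, chanOut]

theorem exists_factorization_of_mem_causalRegion {PS : S → ℝ} {PYX : X → Y → ℝ}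
    (hPS : IsPMF PS) (hPYX : ∀ x, IsPMF (PYX x)) {P : S × X × Y × Z → ℝ} {φ : ℝ}
    (hmem : (P, φ) ∈ causalRegion Z PS PYX)
    (hφ : ∑ s, Real.negMulLog (PS s) -
      ∑ y, Real.negMulLog (∑ s, ∑ x, ∑ z, P (s, x, y, z)) ≤ φ) :
    ∃ (m k : ℕ) (PU : Fin m → ℝ) (PVgSU : S → Fin m → Fin k → ℝ)
      (PXgSU : S → Fin m → X → ℝ) (PZgUVY : Fin m → Fin k → Y → Z → ℝ)
      (Q : S × X × Y × Z × Fin m × Fin k → ℝ),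
      IsPMF PU ∧
      (∀ s u, IsPMF (PVgSU s u)) ∧
      (∀ s u, IsPMF (PXgSU s u)) ∧
      (∀ u v y, IsPMF (PZgUVY u v y)) ∧
      (∀ s x y z u v,
        Q (s, x, y, z, u, v)
          = PS s * PU u * PVgSU s u v * PXgSU s u x * PYX x y * PZgUVY u v y z) ∧
      (∀ s x y z, P (s, x, y, z) = ∑ u, ∑ v, Q (s, x, y, z, u, v)) ∧
      mutInfo Q (fun ω => (ω.2.2.2.2.1, ω.2.2.2.2.2)) (fun ω => ω.1)
        ≤ mutInfo Q (fun ω => (ω.2.2.2.2.1, ω.2.2.2.2.2)) (fun ω => ω.2.2.1) := by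
  obtain ⟨m, k, w, l, t, h, p, hw, hl, hp, hlp, hx⟩ := exists_of_mem_causalRegion hPYX hmem
  obtain ⟨hxP, hxφ⟩ := Prod.ext_iff.1 hx
  simp only [Prod.fst_sum, Prod.snd_sum] at hxP hxφ
  set r : Fin m → Fin k → S → ℝ := fun u v => (w u * l u v) • p u v with hr
  have hr0 : ∀ u v s, 0 ≤ r u v s := fun u v s =>
    mul_nonneg (mul_nonneg (hw.1 u) ((hl u).1 v)) ((hp u v).1 s)
  set Q : S × X × Y × Z × Fin m × Fin k → ℝ := fun ω =>
    (letterPoint PYX (t ω.2.2.2.2.1) (h ω.2.2.2.2.1 ω.2.2.2.2.2)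
      (r ω.2.2.2.2.1 ω.2.2.2.2.2)).1 (ω.1, ω.2.1, ω.2.2.1, ω.2.2.2.1) with hQ
  have hQ0 : ∀ ω, 0 ≤ Q ω := by
    intro ω
    simp only [hQ, letterPoint]
    split_ifs
    · exact mul_nonneg (hr0 _ _ _) ((hPYX _).1 _)
    · exact le_rfl
  have hPQ : ∀ s x y z, P (s, x, y, z) = ∑ u, ∑ v, Q (s, x, y, z, u, v) := by
    intro s x y z
    rw [hxP]
    simp [hQ, hr, Finset.sum_apply]
  refine ⟨m, k, w, fun s u v => if PS s = 0 then l u v else l u v * p u v s / PS s,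
    fun s u x => if x = t u s then 1 else 0, fun u v y z => if z = h u v y then 1 else 0, Q, hw,
    ?_, ?_, ?_, ?_, hPQ, ?_⟩
  · intro s u
    by_cases hs : PS s = 0
    · simpa [hs] using hl u
    · simp only [hs, if_false]
      exact ⟨fun v => div_nonneg (mul_nonneg ((hl u).1 v) ((hp u v).1 s)) (hPS.1 s),
        by rw [← Finset.sum_div, hlp, div_self hs]⟩
  · exact fun s u => ⟨fun x => by positivity, by simp⟩
  · exact fun u v y => ⟨fun x => by positivity, by simp⟩
  · intro s x y z u v
    have hrs : PS s * (if PS s = 0 then l u v else l u v * p u v s / PS s) = l u v * p u v s := by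
      split_ifs with hs
      · have h0 := hlp u s
        rw [hs] at h0
        rw [(Finset.sum_eq_zero_iff_of_nonneg fun v _ =>
          mul_nonneg ((hl u).1 v) ((hp u v).1 s)).1 h0 v (Finset.mem_univ v), hs, zero_mul]
      · field_simp
    have hrs' : r u v s =
        PS s * w u * (if PS s = 0 then l u v else l u v * p u v s / PS s) := by
      rw [mul_right_comm, hrs]
      simp only [hr, Pi.smul_apply, smul_eq_mul]
      ring
    simp only [hQ, letterPoint, ← hrs']
    by_cases hx : x = t u s <;> by_cases hz : z = h u v y <;> simp [hx, hz]
  · have hWS : ∀ u v s, margProb Q (fun ω => ((ω.2.2.2.2.1, ω.2.2.2.2.2), ω.1)) ((u, v), s) =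
        r u v s := by
      intro u v s
      rw [margProb_eq_sum_ite, ← sum_letterPoint hPYX (t u) (h u v) (r u v) s]
      simp [Fintype.sum_prod_type, ite_and, hQ]
    have hWY : ∀ u v y, margProb Q (fun ω => ((ω.2.2.2.2.1, ω.2.2.2.2.2), ω.2.2.1)) ((u, v), y) =
        chanOut PYX (t u) (r u v) y := by
      intro u v y
      rw [margProb_eq_sum_ite, ← sum_letterPoint_output PYX (t u) (h u v) (r u v) y]
      simp [Fintype.sum_prod_type, ite_and, hQ]
    have hS : ∀ s, margProb Q (fun ω => ω.1) s = PS s := by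
      intro s
      rw [← sum_margProb_prodMk_left Q (fun ω => (ω.2.2.2.2.1, ω.2.2.2.2.2)) (fun ω => ω.1) s,
        Fintype.sum_prod_type]
      simp only [hWS, hr, Pi.smul_apply, smul_eq_mul, mul_assoc, ← Finset.mul_sum, hlp]
      rw [← Finset.sum_mul, hw.2, one_mul]
    have hY : ∀ y, margProb Q (fun ω => ω.2.2.1) y = ∑ s, ∑ x, ∑ z, P (s, x, y, z) := by
      intro y
      rw [margProb_eq_sum_ite]
      simp only [Fintype.sum_prod_type, hPQ]
      refine Finset.sum_congr rfl fun s _ => Finset.sum_congr rfl fun x _ => ?_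
      rw [Finset.sum_eq_single y (fun y' _ hy' => by simp [hy']) (by simp)]
      simp
    rw [mutInfo_eq hQ0, mutInfo_eq hQ0]
    refine div_le_div_of_nonneg_right ?_ (Real.log_nonneg one_le_two)
    simp only [natEntropy, hS, hY]
    have e1 : ∑ a, Real.negMulLog
        (margProb Q (fun ω => ((ω.2.2.2.2.1, ω.2.2.2.2.2), ω.1)) a) =
        ∑ u, ∑ v, ∑ s, Real.negMulLog (r u v s) := by
      simp only [Fintype.sum_prod_type, hWS]
    have e2 : ∑ a, Real.negMulLog
        (margProb Q (fun ω => ((ω.2.2.2.2.1, ω.2.2.2.2.2), ω.2.2.1)) a) =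
        ∑ u, ∑ v, ∑ y, Real.negMulLog (chanOut PYX (t u) (r u v) y) := by
      simp only [Fintype.sum_prod_type, hWY]
    rw [e1, e2]
    simp only [letterPoint, Finset.sum_sub_distrib] at hxφ
    linarith

end Extraction

section Code

open scoped Classical

theorem sum_ite_apply_eq_of_update {ι α : Type*} [Fintype ι] [DecidableEq ι] [Fintype α] (i : ι)
    {B : (ι → α) → ℝ} (hB : ∀ x v, B (Function.update x i v) = B x) (a b : α) :
    (∑ x, if x i = a then B x else 0) = ∑ x, if x i = b then B x else 0 := by
  simp only [← Finset.sum_filter]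
  refine Finset.sum_nbij' (fun x => Function.update x i b) (fun x => Function.update x i a)
    (by simp) (by simp) ?_ ?_ (fun x _ => (hB x b).symm)
  · intro x hx
    simp only [Finset.mem_filter_univ] at hx
    simp [← hx]
  · intro x hx
    simp only [Finset.mem_filter_univ] at hx
    simp [← hx]

theorem prod_update_erase {ι α : Type*} [Fintype ι] [DecidableEq ι] (i : ι)
    (F : ι → α → ℝ) (x : ι → α) (v : α) :
    ∏ j ∈ Finset.univ.erase i, F j (Function.update x i v j) =
      ∏ j ∈ Finset.univ.erase i, F j (x j) :=
  Finset.prod_congr rfl fun j hj => by rw [Function.update_of_ne (Finset.ne_of_mem_erase hj)]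

/-- The sequence that agrees with `x` before position `k` and is constantly `x₀` afterwards. -/
def prefixFill {n : ℕ} {α : Type*} (x₀ : α) (k : ℕ) (x : Fin n → α) : Fin n → α :=
  fun j => if (j : ℕ) < k then x j else x₀

theorem prefixFill_update {n : ℕ} {α : Type*} (x₀ : α) (i : Fin n) (x : Fin n → α) (v : α) :
    prefixFill x₀ i (Function.update x i v) = prefixFill x₀ i x := by
  ext j
  unfold prefixFill
  split_ifs with hj
  · rw [Function.update_of_ne (by rintro rfl; exact lt_irrefl _ hj)]
  · rfl

theorem prefixFill_succ_eq_iff {n : ℕ} {α : Type*} (x₀ : α) (i : Fin n) (x x' : Fin n → α) :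
    prefixFill x₀ (i + 1) x' = prefixFill x₀ (i + 1) x ↔
      prefixFill x₀ i x' = prefixFill x₀ i x ∧ x' i = x i := by
  simp only [funext_iff, prefixFill]
  constructor
  · intro h
    refine ⟨fun j => ?_, by simpa using h i⟩
    have := h j
    by_cases hj : (j : ℕ) < i
    · simpa [hj, Nat.lt_succ_of_lt hj] using this
    · simp [hj]
  · rintro ⟨h, hi⟩ j
    by_cases hj : (j : ℕ) < i
    · simpa [hj, Nat.lt_succ_of_lt hj] using h j
    · by_cases hji : j = i
      · simp [hji, hi]
      · have : ¬ (j : ℕ) < i + 1 := fun hlt =>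
          hji (Fin.ext (le_antisymm (Nat.lt_succ_iff.1 hlt) (not_lt.1 hj)))
        simp [this]

theorem update_eq_and_apply_eq_iff {ι α : Type*} [DecidableEq ι] (i : ι) (x₀ : α) (x x' : ι → α) :
    Function.update x' i x₀ = Function.update x i x₀ ∧ x' i = x i ↔ x' = x := by
  constructor
  · rintro ⟨h, hi⟩
    have := congrArg (fun z => Function.update z i (x i)) h
    rwa [← hi, Function.update_idem, Function.update_idem, Function.update_eq_self, hi,
      Function.update_eq_self] at this
  · rintro rfl
    simp

theorem EncOK.apply_update_prefixFill {n : ℕ} {S X : Type*} {f : Fin n → (Fin n → S) → X}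
    (hf : EncOK .causal f) (s₀ : S) (i : Fin n) (s : Fin n → S) :
    f i (Function.update (prefixFill s₀ i s) i (s i)) = f i s := by
  refine hf i _ _ fun j hj => ?_
  rcases eq_or_lt_of_le hj with rfl | hlt
  · simp
  · rw [Function.update_of_ne hlt.ne]
    exact if_pos hlt

variable {S X Y Z : Type} [Fintype S] [Fintype Y] {n : ℕ}
  {PS : S → ℝ} {PYX : X → Y → ℝ} {f : Fin n → (Fin n → S) → X}

theorem isPMF_inducedP (hPS : IsPMF PS) (hPYX : ∀ x, IsPMF (PYX x))
    (f : Fin n → (Fin n → S) → X) : IsPMF (inducedP PS PYX f) := by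
  refine ⟨fun ω => mul_nonneg (Finset.prod_nonneg fun i _ => hPS.1 _)
    (Finset.prod_nonneg fun i _ => (hPYX _).1 _), ?_⟩
  simp only [inducedP, Fintype.sum_prod_type, ← Finset.mul_sum, ← Fintype.prod_sum, (hPYX _).2,
    Finset.prod_const_one, mul_one, hPS.2]

omit [Fintype S] in
theorem sum_inducedP_right (hPYX : ∀ x, IsPMF (PYX x)) (f : Fin n → (Fin n → S) → X)
    (s : Fin n → S) : ∑ y, inducedP PS PYX f (s, y) = ∏ i, PS (s i) := by
  simp only [inducedP, ← Finset.mul_sum, ← Fintype.prod_sum, (hPYX _).2,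
    Finset.prod_const_one, mul_one]

/-- The current output is conditionally independent of all other outputs given the past and
current source symbols. -/
theorem margProb_output (hPYX : ∀ x, IsPMF (PYX x)) (hf : EncOK .causal f) (s₀ : S) (y₀ : Y)
    (i : Fin n) (a : Fin n → S) (c : Fin n → Y) (s : S) (y : Y) :
    margProb (inducedP PS PYX f) (fun ω => (((prefixFill s₀ i ω.1, Function.update ω.2 i y₀),
        ω.1 i), ω.2 i)) (((a, c), s), y) =
      margProb (inducedP PS PYX f) (fun ω => ((prefixFill s₀ i ω.1, Function.update ω.2 i y₀),
        ω.1 i)) ((a, c), s) * PYX (f i (Function.update a i s)) y := by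
  set B : (Fin n → S) → (Fin n → Y) → ℝ := fun s' y' =>
    if Function.update y' i y₀ = c then ∏ j ∈ Finset.univ.erase i, PYX (f j s') (y' j) else 0
    with hB
  have hBu : ∀ s' y' v, B s' (Function.update y' i v) = B s' y' := by
    intro s' y' v
    simp only [hB, Function.update_idem,
      prod_update_erase i (fun j => PYX (f j s')) y' v]
  have hfac : ∀ y, margProb (inducedP PS PYX f) (fun ω => (((prefixFill s₀ i ω.1,
        Function.update ω.2 i y₀), ω.1 i), ω.2 i)) (((a, c), s), y) =
      (∑ s' : Fin n → S, if prefixFill s₀ i s' = a ∧ s' i = s then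
        (∏ j, PS (s' j)) * ∑ y', if y' i = y₀ then B s' y' else 0 else 0) *
        PYX (f i (Function.update a i s)) y := by
    intro y
    rw [margProb_eq_sum_ite, Fintype.sum_prod_type, Finset.sum_mul]
    refine Finset.sum_congr rfl fun s' _ => ?_
    by_cases hs : prefixFill s₀ i s' = a ∧ s' i = s
    · rw [if_pos hs, sum_ite_apply_eq_of_update i (hBu s') y₀ y, mul_assoc, Finset.sum_mul,
        Finset.mul_sum]
      refine Finset.sum_congr rfl fun y' _ => ?_
      obtain ⟨rfl, rfl⟩ := hs
      rw [hf.apply_update_prefixFill]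
      by_cases hy : y' i = y
      · by_cases hc : Function.update y' i y₀ = c
        · simp only [hy, hc, hB, inducedP, if_true]
          rw [← Finset.prod_erase_mul _ (fun j => PYX (f j s') (y' j)) (Finset.mem_univ i), hy]
        · simp [hc, hB]
      · simp [hy]
    · rw [if_neg hs, zero_mul]
      refine Finset.sum_eq_zero fun y' _ => if_neg ?_
      simp only [Prod.mk.injEq]
      tauto
  rw [← sum_margProb_prodMk_right _ (fun ω : (Fin n → S) × (Fin n → Y) =>
    ((prefixFill s₀ i ω.1, Function.update ω.2 i y₀), ω.1 i)) (fun ω => ω.2 i)]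
  simp only [hfac, ← Finset.mul_sum, (hPYX _).2, mul_one]

/-- The current source symbol is independent of the past ones. -/
theorem margProb_source (hPS : IsPMF PS) (hPYX : ∀ x, IsPMF (PYX x))
    (f : Fin n → (Fin n → S) → X) (s₀ : S) (i : Fin n) (a : Fin n → S) (s : S) :
    margProb (inducedP PS PYX f) (fun ω => (prefixFill s₀ i ω.1, ω.1 i)) (a, s) =
      margProb (inducedP PS PYX f) (fun ω => prefixFill s₀ i ω.1) a * PS s := by
  set B : (Fin n → S) → ℝ := fun s' =>
    if prefixFill s₀ i s' = a then ∏ j ∈ Finset.univ.erase i, PS (s' j) else 0 with hB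
  have hBu : ∀ s' v, B (Function.update s' i v) = B s' := by
    intro s' v
    simp only [hB, prefixFill_update, prod_update_erase i (fun _ => PS) s' v]
  have hfac : ∀ s, margProb (inducedP PS PYX f) (fun ω => (prefixFill s₀ i ω.1, ω.1 i)) (a, s) =
      (∑ s', if s' i = s₀ then B s' else 0) * PS s := by
    intro s
    rw [margProb_eq_sum_ite, Fintype.sum_prod_type, sum_ite_apply_eq_of_update i hBu s₀ s,
      Finset.sum_mul]
    refine Finset.sum_congr rfl fun s' _ => ?_
    by_cases hs : s' i = s
    · by_cases ha : prefixFill s₀ i s' = a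
      · simp only [hs, ha, if_true, hB, sum_inducedP_right hPYX]
        rw [← Finset.prod_erase_mul _ _ (Finset.mem_univ i), hs]
      · simp [ha, hB]
    · simp [hs]
  rw [← sum_margProb_prodMk_right _ (fun ω : (Fin n → S) × (Fin n → Y) => prefixFill s₀ i ω.1)
    (fun ω => ω.1 i)]
  simp only [hfac, ← Finset.mul_sum, hPS.2, mul_one]

theorem margProb_source_apply (hPS : IsPMF PS) (hPYX : ∀ x, IsPMF (PYX x))
    (f : Fin n → (Fin n → S) → X) (i : Fin n) (s : S) :
    margProb (inducedP PS PYX f) (fun ω => ω.1 i) s = PS s := by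
  rw [← sum_margProb_prodMk_left _ (fun ω : (Fin n → S) × (Fin n → Y) => prefixFill s i ω.1)
    (fun ω => ω.1 i)]
  simp only [margProb_source hPS hPYX]
  rw [← Finset.sum_mul, sum_margProb, (isPMF_inducedP hPS hPYX f).2, one_mul]

/-- Single-letterization of `H(Sᵢ | Sⁱ⁻¹, Y^{∖i}) - H(Yᵢ | Sⁱ⁻¹, Y^{∖i})`. -/
theorem sum_natEntropy_sub (hPS : IsPMF PS) (hPYX : ∀ x, IsPMF (PYX x)) (hf : EncOK .causal f)
    (s₀ : S) (y₀ : Y) :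
    ∑ i : Fin n, (natEntropy (inducedP PS PYX f) (fun ω => ((prefixFill s₀ i ω.1,
        Function.update ω.2 i y₀), ω.1 i)) -
      natEntropy (inducedP PS PYX f) (fun ω => ((prefixFill s₀ i ω.1,
        Function.update ω.2 i y₀), ω.2 i))) =
    n * ∑ s, Real.negMulLog (PS s) -
      natEntropy (inducedP PS PYX f) (fun ω => ω.2) := by
  set p := inducedP PS PYX f with hp
  have hp0 : ∀ ω, 0 ≤ p ω := (isPMF_inducedP hPS hPYX f).1
  set L : ℕ → (Fin n → S) × (Fin n → Y) → ℝ := fun k ω =>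
    Real.log (margProb p (fun ω' => (prefixFill s₀ k ω'.1, ω'.2)) (prefixFill s₀ k ω.1, ω.2))
    with hL
  have hWY : ∀ (i : Fin n) ω, Real.log (margProb p (fun ω' => ((prefixFill s₀ i ω'.1,
      Function.update ω'.2 i y₀), ω'.2 i)) ((prefixFill s₀ i ω.1,
      Function.update ω.2 i y₀), ω.2 i)) = L i ω := by
    intro i ω
    simp only [hL]
    congr 1
    refine margProb_congr p fun ω' => ?_
    simp only [Prod.mk.injEq, and_assoc, update_eq_and_apply_eq_iff]
  have hWS : ∀ (i : Fin n) ω, p ω ≠ 0 → Real.log (margProb p (fun ω' => ((prefixFill s₀ i ω'.1,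
      Function.update ω'.2 i y₀), ω'.1 i)) ((prefixFill s₀ i ω.1,
      Function.update ω.2 i y₀), ω.1 i)) =
      L (i + 1) ω - Real.log (PYX (f i ω.1) (ω.2 i)) := by
    intro i ω hω
    have hfac := margProb_output (PS := PS) hPYX hf s₀ y₀ i (prefixFill s₀ i ω.1)
      (Function.update ω.2 i y₀) (ω.1 i) (ω.2 i)
    rw [hf.apply_update_prefixFill, ← hp] at hfac
    have hcongr : margProb p (fun ω' => (((prefixFill s₀ i ω'.1,
        Function.update ω'.2 i y₀), ω'.1 i), ω'.2 i)) (((prefixFill s₀ i ω.1,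
        Function.update ω.2 i y₀), ω.1 i), ω.2 i) =
        margProb p (fun ω' => (prefixFill s₀ (i + 1) ω'.1, ω'.2))
          (prefixFill s₀ (i + 1) ω.1, ω.2) := by
      refine margProb_congr p fun ω' => ?_
      simp only [Prod.mk.injEq, prefixFill_succ_eq_iff, ← update_eq_and_apply_eq_iff i y₀ ω.2 ω'.2]
      tauto
    have hpos : 0 < margProb p (fun ω' => (prefixFill s₀ (i + 1) ω'.1, ω'.2))
        (prefixFill s₀ (i + 1) ω.1, ω.2) :=
      ((hp0 ω).lt_of_ne' hω).trans_le
        (le_margProb hp0 (fun ω' => (prefixFill s₀ (i + 1) ω'.1, ω'.2)) ω)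
    rw [hcongr] at hfac
    simp only [hL]
    rw [hfac] at hpos ⊢
    rw [Real.log_mul (left_ne_zero_of_mul hpos.ne') (right_ne_zero_of_mul hpos.ne'),
      add_sub_cancel_right]
  have hend : ∀ ω, L n ω = Real.log (p ω) := by
    intro ω
    have hfill : ∀ x : Fin n → S, prefixFill s₀ n x = x := fun x => by
      ext j
      simp [prefixFill]
    simp only [hL, hfill]
    rw [margProb_eq_sum_ite]
    simp
  have hstart : ∀ ω, L 0 ω = Real.log (margProb p (fun ω' => ω'.2) ω.2) := by
    intro ω
    simp only [hL]
    congr 1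
    refine margProb_congr p fun ω' => ?_
    simp [funext_iff, prefixFill]
  have hlog : ∀ ω, p ω ≠ 0 → Real.log (p ω) =
      ∑ i, Real.log (PS (ω.1 i)) + ∑ i, Real.log (PYX (f i ω.1) (ω.2 i)) := by
    intro ω hω
    simp only [hp, inducedP] at hω ⊢
    rw [Real.log_mul (left_ne_zero_of_mul hω) (right_ne_zero_of_mul hω),
      Real.log_prod (fun i _ => Finset.prod_ne_zero_iff.1 (left_ne_zero_of_mul hω) i
        (Finset.mem_univ i)),
      Real.log_prod (fun i _ => Finset.prod_ne_zero_iff.1 (right_ne_zero_of_mul hω) i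
        (Finset.mem_univ i))]
  have hsource : n * ∑ s, Real.negMulLog (PS s) =
      -∑ ω, p ω * ∑ i, Real.log (PS (ω.1 i)) := by
    have : ∀ i : Fin n, ∑ s, Real.negMulLog (PS s) = -∑ ω, p ω * Real.log (PS (ω.1 i)) := by
      intro i
      rw [← sum_margProb_mul p (fun ω => ω.1 i) fun s => Real.log (PS s)]
      simp [hp, margProb_source_apply hPS hPYX, Real.negMulLog]
    simp only [Finset.mul_sum _ _ (p _)]
    rw [Finset.sum_comm, ← Finset.sum_neg_distrib, ← Finset.sum_congr rfl fun i _ => this i]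
    simp
  rw [hsource, natEntropy_eq_sum]
  simp only [natEntropy_eq_sum, hWY]
  simp only [← Finset.sum_neg_distrib, ← Finset.sum_sub_distrib]
  rw [Finset.sum_comm]
  refine Finset.sum_congr rfl fun ω _ => ?_
  rcases eq_or_ne (p ω) 0 with hω | hω
  · simp [hω]
  simp only [hWS _ ω hω]
  have htel : ∑ i : Fin n, (L (i + 1) ω - L i ω) = L n ω - L 0 ω := by
    rw [Fin.sum_univ_eq_sum_range (fun k => L (k + 1) ω - L k ω) n, Finset.sum_range_sub (L · ω)]
  have hrearr : ∀ i : Fin n, -(p ω * (L (i + 1) ω - Real.log (PYX (f i ω.1) (ω.2 i)))) -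
      -(p ω * L i ω) = p ω * (Real.log (PYX (f i ω.1) (ω.2 i)) - (L (i + 1) ω - L i ω)) :=
    fun i => by ring
  rw [Finset.sum_congr rfl fun i _ => hrearr i, ← Finset.mul_sum, Finset.sum_sub_distrib, htel,
    hend, hstart, hlog ω hω]
  ring

end Code

section SingleLetter

open scoped Classical

variable {S X Y Z : Type} [Fintype S] [Fintype X] [Fintype Y] [Fintype Z] {n : ℕ}
  {PS : S → ℝ} {PYX : X → Y → ℝ}

/-- The time-averaged joint pmf of `(Sᵢ, Xᵢ, Yᵢ, Ŝᵢ)` for a block code. -/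
def averagePMF (PS : S → ℝ) (PYX : X → Y → ℝ) (f : Fin n → (Fin n → S) → X)
    (g : Fin n → (Fin n → Y) → Z) (a : S × X × Y × Z) : ℝ :=
  (n : ℝ)⁻¹ * ∑ i, margProb (inducedP PS PYX f)
    (fun ω => (ω.1 i, f i ω.1, ω.2 i, g i ω.2)) a

omit [Fintype X] [Fintype Z] in
theorem sum_inducedP_mul_empDist (f : Fin n → (Fin n → S) → X)
    (g : Fin n → (Fin n → Y) → Z) (a : S × X × Y × Z) :
    ∑ ω, inducedP PS PYX f ω * empDist (fun i => (ω.1 i, f i ω.1, ω.2 i, g i ω.2)) a =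
      averagePMF PS PYX f g a := by
  simp only [averagePMF, margProb_eq_sum_ite, empDist, Set.indicator_apply, Set.mem_ofPred_eq]
  rw [Finset.sum_comm, Finset.mul_sum]
  refine Finset.sum_congr rfl fun ω _ => ?_
  rw [div_eq_inv_mul, mul_left_comm, Finset.mul_sum]
  refine congrArg _ (Finset.sum_congr rfl fun i _ => ?_)
  by_cases h : (ω.1 i, f i ω.1, ω.2 i, g i ω.2) = a <;> simp [h]

theorem sum_averagePMF_output (f : Fin n → (Fin n → S) → X) (g : Fin n → (Fin n → Y) → Z) (y : Y) :
    ∑ s, ∑ x, ∑ z, averagePMF PS PYX f g (s, x, y, z) =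
      (n : ℝ)⁻¹ * ∑ i, margProb (inducedP PS PYX f) (fun ω => ω.2 i) y := by
  have key : ∀ i, ∑ s, ∑ x, ∑ z, margProb (inducedP PS PYX f)
      (fun ω => (ω.1 i, f i ω.1, ω.2 i, g i ω.2)) (s, x, y, z) =
      margProb (inducedP PS PYX f) (fun ω => ω.2 i) y := by
    intro i
    rw [← sum_margProb_prodMk_left (inducedP PS PYX f) (fun ω => ω.1 i) (fun ω => ω.2 i) y]
    refine Finset.sum_congr rfl fun s _ => ?_
    rw [← sum_margProb_prodMk_left (inducedP PS PYX f) (fun ω => f i ω.1)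
      (fun ω => (ω.1 i, ω.2 i)) (s, y)]
    refine Finset.sum_congr rfl fun x _ => ?_
    rw [← sum_margProb_prodMk_left (inducedP PS PYX f) (fun ω => g i ω.2)
      (fun ω => (f i ω.1, ω.1 i, ω.2 i)) (x, s, y)]
    refine Finset.sum_congr rfl fun z _ => margProb_congr _ fun ω => ?_
    simp only [Prod.mk.injEq]
    tauto
  simp only [averagePMF, ← Finset.mul_sum, ← key]
  congr 1
  simp only [Finset.sum_comm (t := (Finset.univ : Finset (Fin n)))]

theorem natEntropy_outputs_le (hn : 0 < n) (hPS : IsPMF PS) (hPYX : ∀ x, IsPMF (PYX x))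
    (f : Fin n → (Fin n → S) → X) (g : Fin n → (Fin n → Y) → Z) :
    natEntropy (inducedP PS PYX f) (fun ω => ω.2) ≤
      n * ∑ y, Real.negMulLog (∑ s, ∑ x, ∑ z, averagePMF PS PYX f g (s, x, y, z)) := by
  have hp := isPMF_inducedP hPS hPYX f
  set p := inducedP PS PYX f
  have hn' : (n : ℝ) ≠ 0 := by positivity
  set R : Y → ℝ := fun y => (n : ℝ)⁻¹ * ∑ i, margProb p (fun ω => ω.2 i) y with hR
  have hR0 : ∀ y, 0 ≤ R y := fun y =>
    mul_nonneg (by positivity) (Finset.sum_nonneg fun i _ => margProb_nonneg hp.1 _ _)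
  have hRpmf : IsPMF fun y : Fin n → Y => ∏ i, R (y i) := by
    refine ⟨fun y => Finset.prod_nonneg fun i _ => hR0 _, ?_⟩
    have hR1 : ∑ y, R y = 1 := by
      simp only [hR, ← Finset.mul_sum]
      rw [Finset.sum_comm]
      simp [sum_margProb, hp.2, hn']
    rw [← Fintype.prod_sum]
    simp [hR1]
  have hpos : ∀ ω, p ω ≠ 0 → ∀ i, 0 < R (ω.2 i) := by
    intro ω hω i
    refine mul_pos (by positivity) (((hp.1 ω).lt_of_ne' hω).trans_le ?_)
    refine (le_margProb hp.1 (fun ω => ω.2 i) ω).trans ?_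
    exact Finset.single_le_sum (f := fun j => margProb p (fun ω' => ω'.2 j) (ω.2 i))
      (fun j _ => margProb_nonneg hp.1 _ _) (Finset.mem_univ i)
  refine (natEntropy_le_sum_log hp (fun ω => ω.2) hRpmf
    fun ω hω => Finset.prod_pos fun i _ => hpos ω hω i).trans_eq ?_
  have hlog : ∀ ω, p ω * Real.log (∏ i, R (ω.2 i)) = ∑ i, p ω * Real.log (R (ω.2 i)) := by
    intro ω
    rcases eq_or_ne (p ω) 0 with hω | hω
    · simp [hω]
    rw [Real.log_prod fun i _ => (hpos ω hω i).ne', Finset.mul_sum]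
  simp only [sum_averagePMF_output]
  rw [Finset.sum_congr rfl fun ω _ => hlog ω, Finset.sum_comm]
  simp only [← fun i => sum_margProb_mul p (fun ω => ω.2 i) fun y => Real.log (R y)]
  rw [Finset.sum_comm, Finset.mul_sum, ← Finset.sum_neg_distrib]
  refine Finset.sum_congr rfl fun y _ => ?_
  have : ∑ i, margProb p (fun ω => ω.2 i) y = n * R y := by
    simp only [hR]
    field_simp
  rw [← Finset.sum_mul, this, inv_mul_cancel_left₀ hn', Real.negMulLog]
  ring

theorem exists_mem_causalRegion_of_code (hn : 0 < n) (hPS : IsPMF PS)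
    (hPYX : ∀ x, IsPMF (PYX x)) (y₀ : Y) {f : Fin n → (Fin n → S) → X} (hf : EncOK .causal f)
    (g : Fin n → (Fin n → Y) → Z) :
    ∃ φ, (averagePMF PS PYX f g, φ) ∈ causalRegion Z PS PYX ∧
      ∑ s, Real.negMulLog (PS s) -
        ∑ y, Real.negMulLog (∑ s, ∑ x, ∑ z, averagePMF PS PYX f g (s, x, y, z)) ≤ φ := by
  obtain ⟨s₀⟩ : Nonempty S := by
    by_contra hne
    rw [not_nonempty_iff] at hne
    simpa using hPS.2
  have hn' : (n : ℝ) ≠ 0 := by positivity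
  have hp := isPMF_inducedP hPS hPYX f
  set p := inducedP PS PYX f with hpdef
  let W : Fin n → (Fin n → S) × (Fin n → Y) → (Fin n → S) × (Fin n → Y) := fun i ω =>
    (prefixFill s₀ i ω.1, Function.update ω.2 i y₀)
  let q : Fin n → (Fin n → S) → (Fin n → Y) → S → ℝ := fun i a c s =>
    margProb p (fun ω => (W i ω, ω.1 i)) ((a, c), s)
  let t : Fin n → (Fin n → S) → S → X := fun i a s => f i (Function.update a i s)
  let h : Fin n → (Fin n → Y) → Y → Z := fun i c y => g i (Function.update c i y)
  have hout : ∀ i a c s y, margProb p (fun ω => ((W i ω, ω.1 i), ω.2 i)) (((a, c), s), y) =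
      q i a c s * PYX (t i a s) y := fun i a c s y => margProb_output hPYX hf s₀ y₀ i a c s y
  have hmem := sum_letterPoint_mem_causalRegion hPS hPYX
    (fun u : Fin n × (Fin n → S) => t u.1 u.2) (fun u c => h u.1 c)
    (fun u => (n : ℝ)⁻¹ * margProb p (fun ω => prefixFill s₀ u.1 ω.1) u.2)
    (fun u => mul_nonneg (by positivity) (margProb_nonneg hp.1 _ _))
    (by
      rw [Fintype.sum_prod_type]
      simp [← Finset.mul_sum, sum_margProb, hp.2, hn'])
    (fun u c => (n : ℝ)⁻¹ • q u.1 u.2 c)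
    (fun u c s => mul_nonneg (by positivity) (margProb_nonneg hp.1 _ _))
    (by
      intro u s
      simp only [Pi.smul_apply, smul_eq_mul, ← Finset.mul_sum, mul_assoc]
      rw [← margProb_source hPS hPYX, ← hpdef]
      congr 1
      rw [← sum_margProb_prodMk_left p (fun ω => Function.update ω.2 u.1 y₀)
        (fun ω => (prefixFill s₀ u.1 ω.1, ω.1 u.1))]
      refine Finset.sum_congr rfl fun c _ => margProb_congr p fun ω => ?_
      simp only [W, Prod.mk.injEq]
      tauto)
  simp only [letterPoint_smul hPYX, ← Finset.smul_sum, Fintype.sum_prod_type] at hmem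
  set pt := (n : ℝ)⁻¹ • ∑ i, ∑ a, ∑ c, letterPoint PYX (t i a) (h i c) (q i a c) with hpt
  have hfst : pt.1 = averagePMF PS PYX f g := by
    ext ⟨s, x, y, z⟩
    simp only [hpt, averagePMF, Prod.smul_fst, Prod.fst_sum, Pi.smul_apply, Finset.sum_apply,
      smul_eq_mul]
    congr 1
    refine Finset.sum_congr rfl fun i _ => ?_
    have hF := sum_margProb_mul p (fun ω => ((W i ω, ω.1 i), ω.2 i)) fun b =>
      if b.1.2 = s ∧ b.2 = y ∧ x = t i b.1.1.1 b.1.2 ∧ z = h i b.1.1.2 b.2 then 1 else 0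
    have hl : ∑ b, margProb p (fun ω => ((W i ω, ω.1 i), ω.2 i)) b *
        (if b.1.2 = s ∧ b.2 = y ∧ x = t i b.1.1.1 b.1.2 ∧ z = h i b.1.1.2 b.2 then 1 else 0) =
        ∑ a, ∑ c, (letterPoint PYX (t i a) (h i c) (q i a c)).1 (s, x, y, z) := by
      simp only [Fintype.sum_prod_type, hout]
      refine Finset.sum_congr rfl fun a _ => Finset.sum_congr rfl fun c _ => ?_
      rw [Finset.sum_eq_single s (fun s' _ hs' => by simp [hs']) (by simp),
        Finset.sum_eq_single y (fun y' _ hy' => by simp [hy']) (by simp)]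
      by_cases hx : x = t i a s <;> by_cases hz : z = h i c y <;> simp [letterPoint, hx, hz]
    rw [← hl, hF, margProb_eq_sum_ite]
    refine Finset.sum_congr rfl fun ω _ => ?_
    have hX : t i (W i ω).1 (ω.1 i) = f i ω.1 := hf.apply_update_prefixFill s₀ i ω.1
    have hZ : h i (W i ω).2 (ω.2 i) = g i ω.2 := by simp [h, W]
    rw [hX, hZ, mul_ite, mul_one, mul_zero]
    have hiff : ((ω.1 i, f i ω.1, ω.2 i, g i ω.2) = (s, x, y, z)) ↔
        (ω.1 i = s ∧ ω.2 i = y ∧ x = f i ω.1 ∧ z = g i ω.2) := by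
      simp only [Prod.mk.injEq, eq_comm (a := x), eq_comm (a := z)]
      tauto
    by_cases hc : (ω.1 i, f i ω.1, ω.2 i, g i ω.2) = (s, x, y, z)
    · rw [if_pos (hiff.1 hc), if_pos hc]
    · rw [if_neg (mt hiff.2 hc), if_neg hc]
  have hsnd : pt.2 = (n : ℝ)⁻¹ * ∑ i, (natEntropy p (fun ω => (W i ω, ω.1 i)) -
      natEntropy p (fun ω => (W i ω, ω.2 i))) := by
    simp only [hpt, Prod.smul_snd, Prod.snd_sum, smul_eq_mul]
    congr 1
    refine Finset.sum_congr rfl fun i _ => ?_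
    have hchan : ∀ a c y, chanOut PYX (t i a) (q i a c) y =
        margProb p (fun ω => (W i ω, ω.2 i)) ((a, c), y) := by
      intro a c y
      rw [← sum_margProb_prodMk_left p (fun ω => ω.1 i) (fun ω => (W i ω, ω.2 i))]
      refine Finset.sum_congr rfl fun s _ => ?_
      rw [← hout]
      refine margProb_congr p fun ω => ?_
      simp only [Prod.mk.injEq]
      tauto
    simp only [letterPoint, natEntropy, Fintype.sum_prod_type, hchan, Finset.sum_sub_distrib, q]
  refine ⟨pt.2, ?_, ?_⟩
  · rw [← hfst]
    exact hmem
  · rw [hsnd, sum_natEntropy_sub hPS hPYX hf s₀ y₀]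
    have hle := natEntropy_outputs_le hn hPS hPYX f g
    have hinv := mul_le_mul_of_nonneg_left hle (inv_nonneg.2 (Nat.cast_nonneg (α := ℝ) n))
    rw [inv_mul_cancel_left₀ hn'] at hinv
    rw [mul_sub, inv_mul_cancel_left₀ hn']
    linarith

omit [Fintype X] [Fintype Z] in
theorem empDist_mem_Icc {α : Type*} (w : Fin n → α) (a : α) : empDist w a ∈ Set.Icc (0 : ℝ) 1 := by
  have h0 : ∀ i, ({i | w i = a} : Set (Fin n)).indicator (fun _ => (1 : ℝ)) i ∈
      Set.Icc (0 : ℝ) 1 := fun i => by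
    rw [Set.indicator_apply]
    split_ifs <;> simp
  refine ⟨div_nonneg (Finset.sum_nonneg fun i _ => (h0 i).1) (Nat.cast_nonneg n),
    div_le_one_of_le₀ ?_ (Nat.cast_nonneg n)⟩
  simpa using Finset.sum_le_sum fun i (_ : i ∈ Finset.univ) => (h0 i).2

theorem abs_averagePMF_sub_le (hPS : IsPMF PS) (hPYX : ∀ x, IsPMF (PYX x))
    {P : S × X × Y × Z → ℝ} (hP : IsPMF P) (f : Fin n → (Fin n → S) → X)
    (g : Fin n → (Fin n → Y) → Z) {ε : ℝ}
    (hε : prob (inducedP PS PYX f) {ω | ε <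
      tvDist (empDist (fun i => (ω.1 i, f i ω.1, ω.2 i, g i ω.2))) P} < ε)
    (a : S × X × Y × Z) : |averagePMF PS PYX f g a - P a| ≤ 3 * ε := by
  have hp := isPMF_inducedP hPS hPYX f
  have hε0 : 0 ≤ ε := by
    refine le_trans (Finset.sum_nonneg fun ω _ => ?_) hε.le
    exact Set.indicator_nonneg (fun ω _ => hp.1 ω) ω
  have hP1 : P a ≤ 1 := by
    rw [← hP.2]
    exact Finset.single_le_sum (fun b _ => hP.1 b) (Finset.mem_univ a)
  set p := inducedP PS PYX f with hpdef
  set e : (Fin n → S) × (Fin n → Y) → S × X × Y × Z → ℝ := fun ω =>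
    empDist (fun i => (ω.1 i, f i ω.1, ω.2 i, g i ω.2)) with he
  have hrepr : averagePMF PS PYX f g a - P a = ∑ ω, p ω * (e ω a - P a) := by
    rw [← sum_inducedP_mul_empDist, ← hpdef]
    simp only [mul_sub, Finset.sum_sub_distrib, ← Finset.sum_mul, hp.2, one_mul, he]
  have hterm : ∀ ω, |p ω * (e ω a - P a)| ≤
      p ω * (2 * ε) + Set.indicator {ω | ε < tvDist (e ω) P} p ω := by
    intro ω
    rw [abs_mul, abs_of_nonneg (hp.1 ω), Set.indicator_apply]
    split_ifs with hω
    · have hI := empDist_mem_Icc (fun i => (ω.1 i, f i ω.1, ω.2 i, g i ω.2)) a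
      have : |e ω a - P a| ≤ 1 :=
        abs_sub_le_iff.2 ⟨by linarith [hI.2, hP.1 a], by linarith [hI.1]⟩
      nlinarith [hp.1 ω, mul_le_mul_of_nonneg_left this (hp.1 ω), mul_nonneg (hp.1 ω) hε0]
    · have htv : tvDist (e ω) P ≤ ε := not_lt.1 hω
      have hle : |e ω a - P a| ≤ ∑ b, |e ω b - P b| :=
        Finset.single_le_sum (f := fun b => |e ω b - P b|) (fun b _ => abs_nonneg _)
          (Finset.mem_univ a)
      rw [tvDist] at htv
      rw [add_zero]
      exact mul_le_mul_of_nonneg_left (by linarith) (hp.1 ω)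
  rw [hrepr]
  refine (Finset.abs_sum_le_sum_abs _ _).trans
    ((Finset.sum_le_sum fun ω _ => hterm ω).trans ?_)
  rw [Finset.sum_add_distrib, ← Finset.sum_mul, hp.2, one_mul]
  have : ∑ ω, Set.indicator {ω | ε < tvDist (e ω) P} p ω ≤ ε := hε.le
  linarith

theorem exists_mem_causalRegion_of_achievable (hPS : IsPMF PS) (hPYX : ∀ x, IsPMF (PYX x))
    {P : S × X × Y × Z → ℝ} (hP : IsPMF P) (hach : Achievable PS PYX .causal P) :
    ∃ φ, (P, φ) ∈ causalRegion Z PS PYX ∧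
      ∑ s, Real.negMulLog (PS s) -
        ∑ y, Real.negMulLog (∑ s, ∑ x, ∑ z, P (s, x, y, z)) ≤ φ := by
  obtain ⟨⟨-, -, y₀, -⟩⟩ : Nonempty (S × X × Y × Z) := by
    by_contra hne
    rw [not_nonempty_iff] at hne
    simpa using hP.2
  set K : Set ((S × X × Y × Z → ℝ) × ℝ) := causalRegion Z PS PYX ∩
    {x | ∑ s, Real.negMulLog (PS s) -
      ∑ y, Real.negMulLog (∑ s, ∑ x', ∑ z, x.1 (s, x', y, z)) ≤ x.2} with hK
  have hKc : IsCompact K := by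
    refine (isCompact_causalRegion PS PYX).inter_right (isClosed_le ?_ continuous_snd)
    have := Real.continuous_negMulLog
    fun_prop
  have hclosed : IsClosed (Prod.fst '' K) := (hKc.image continuous_fst).isClosed
  have hPmem : P ∈ Prod.fst '' K := by
    refine hclosed.closure_subset (Metric.mem_closure_iff.2 fun δ hδ => ?_)
    obtain ⟨n, hn, f, g, hf, hε⟩ := hach (δ / 4) (by positivity)
    obtain ⟨φ, hφ, hle⟩ := exists_mem_causalRegion_of_code hn hPS hPYX y₀ hf g
    refine ⟨_, ⟨(averagePMF PS PYX f g, φ), ⟨hφ, hle⟩, rfl⟩, ?_⟩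
    rw [dist_comm]
    refine lt_of_le_of_lt ((dist_pi_le_iff (by positivity : 0 ≤ 3 * (δ / 4))).2 fun a => ?_)
      (by linarith)
    rw [Real.dist_eq]
    exact abs_averagePMF_sub_le hPS hPYX hP f g hε a
  obtain ⟨⟨P', φ⟩, ⟨hmem, hle⟩, rfl⟩ := hPmem
  exact ⟨φ, hmem, hle⟩

end SingleLetter

/-- **Theorem 2 (Causal encoder, converse).**
If the pmf `P` on `S × X × Y × Ŝ` is achievable with a causal encoder, then there
exist finite sets `𝒰 = Fin m`, `𝒱 = Fin k` and a joint pmf `Q` on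
`S × X × Y × Ŝ × 𝒰 × 𝒱` whose `(S,X,Y,Ŝ)`-marginal is `P`, which factors as
`P_S · P_U · P_{V|SU} · P_{X|SU} · P_{Y|X} · P_{Ŝ|UVY}`, and which satisfies
`I(U,V;S) ≤ I(U,V;Y)`. -/
theorem causal_converse
    {S X Y Z : Type} [Fintype S] [Fintype X] [Fintype Y] [Fintype Z]
    (PS : S → ℝ) (PYX : X → Y → ℝ)
    (hPS : IsPMF PS) (hPYX : ∀ x, IsPMF (PYX x))
    (P : S × X × Y × Z → ℝ) (hP : IsPMF P)
    (hach : Achievable PS PYX EncoderClass.causal P) :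
    ∃ (m k : ℕ) (PU : Fin m → ℝ) (PVgSU : S → Fin m → Fin k → ℝ)
      (PXgSU : S → Fin m → X → ℝ) (PZgUVY : Fin m → Fin k → Y → Z → ℝ)
      (Q : S × X × Y × Z × Fin m × Fin k → ℝ),
      IsPMF PU ∧
      (∀ s u, IsPMF (PVgSU s u)) ∧
      (∀ s u, IsPMF (PXgSU s u)) ∧
      (∀ u v y, IsPMF (PZgUVY u v y)) ∧
      (∀ s x y z u v,
        Q (s, x, y, z, u, v)
          = PS s * PU u * PVgSU s u v * PXgSU s u x * PYX x y * PZgUVY u v y z) ∧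
      (∀ s x y z, P (s, x, y, z) = ∑ u, ∑ v, Q (s, x, y, z, u, v)) ∧
      mutInfo Q (fun ω => (ω.2.2.2.2.1, ω.2.2.2.2.2)) (fun ω => ω.1)
        ≤ mutInfo Q (fun ω => (ω.2.2.2.2.1, ω.2.2.2.2.2)) (fun ω => ω.2.2.1) := by
  obtain ⟨φ, hmem, hφ⟩ := exists_mem_causalRegion_of_achievable hPS hPYX hP hach
  exact exists_factorization_of_mem_causalRegion hPS hPYX hmem hφ

end
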